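/- Let α be a real number with sin α ≠ 0, cos α ≠ 0, and let r be any real number. Set D = r²·sin(2α) + r. Then both M₋ = 2r + tan α and M₊ = −2r − (cos α)/(sin α) satisfy the quadratic equation (M² − 1)·sin(2α) + 2M·cos(2α) = 4D. -/

import Mathlib

/-- Both `M₋ = 2r + tan α` and `M₊ = -2r - cot α` solve the quadratic equation
`(M² - 1)·sin 2α + 2M·cos 2α = 4D` with `D = r²·sin 2α + r`. -/
theorem wyss_quadratic_solutions
    (α r : ℝ) (hs : Real.sin α ≠ 0) (hc : Real.cos α ≠ 0)
    (D : ℝ) (hD : D = r ^ 2 * Real.sin (2 * α) + r) :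
    (((2 * r + Real.tan α) ^ 2 - 1) * Real.sin (2 * α)
        + 2 * (2 * r + Real.tan α) * Real.cos (2 * α) = 4 * D) ∧
    (((-2 * r - Real.cos α / Real.sin α) ^ 2 - 1) * Real.sin (2 * α)
        + 2 * (-2 * r - Real.cos α / Real.sin α) * Real.cos (2 * α) = 4 * D) := by
  have p := Real.sin_sq_add_cos_sq α
  have ht : Real.tan α * Real.cos α = Real.sin α := Real.tan_mul_cos hc
  have hu : Real.cos α / Real.sin α * Real.sin α = Real.cos α := div_mul_cancel₀ _ hs
  rw [hD, Real.sin_two_mul, Real.cos_two_mul']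
  generalize Real.cos α / Real.sin α = u at *
  generalize Real.tan α = t at *
  generalize Real.sin α = s at *
  generalize Real.cos α = c at *
  constructor
  · linear_combination (8 * r * s + 2 * t * s + 2 * c) * ht + 4 * r * p
  · linear_combination (8 * r * c + 2 * u * c + 2 * s) * hu + 4 * r * p
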